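/- Let R₀ = ℤ[a₀, a₂, a₃, a₄, z] and let Δ₀ ∈ R₀ be the discriminant of the Weierstrass curve over R₀ with coefficients (a₁, a₂, a₃, a₄, a₆) = (0, a₄z, a₃z², a₂z³, a₀z⁵) (i.e. the specialization of the E₈-unfolding curve to a₅ = 0). Then Δ₀ ≡ −16·a₃²·a₄³·z⁷ (mod z⁸) in R₀. In particular, at a generic point of the curve a₅ = 0 (where a₃ and a₄ are nonzero) the discriminant vanishes along z = 0 to order exactly 7, corresponding to the enhancement of the A₄ singularity of the ALE fiber to D₅ along the matter curve Σ₁₀ on which the 10 and 10̄ matter of the SU(5) GUT propagates. -/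

import Mathlib

open MvPolynomial

/-- The coefficient `a₀` in the unfolding of the `E₈` singularity. -/
noncomputable def a0 : MvPolynomial (Fin 5) ℤ := X 0
/-- The coefficient `a₂`. -/
noncomputable def a2 : MvPolynomial (Fin 5) ℤ := X 1
/-- The coefficient `a₃`. -/
noncomputable def a3 : MvPolynomial (Fin 5) ℤ := X 2
/-- The coefficient `a₄`. -/
noncomputable def a4 : MvPolynomial (Fin 5) ℤ := X 3
/-- The coordinate `z` on the base, vanishing on the GUT surface `S`. -/
noncomputable def z : MvPolynomial (Fin 5) ℤ := X 4

/-- The Weierstrass curve `y² + a₃z²y = x³ + a₄zx² + a₂z³x + a₀z⁵`, the specialization of the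
unfolding of the `E₈` singularity with unbroken `SU(5)` to `a₅ = 0`, i.e. to the `Σ₁₀` matter
curve. -/
noncomputable def W0 : WeierstrassCurve (MvPolynomial (Fin 5) ℤ) :=
  ⟨0, a4 * z, a3 * z ^ 2, a2 * z ^ 3, a0 * z ^ 5⟩

/-- Along the matter curve `Σ₁₀` (the locus `a₅ = 0`), the discriminant of the `E₈`-unfolding
Weierstrass curve satisfies `Δ₀ ≡ −16·a₃²·a₄³·z⁷ (mod z⁸)`: the `A₄` singularity enhances to `D₅`
and the discriminant generically vanishes to order exactly `7` along `z = 0`. -/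
theorem discriminant_mod_z_pow_eight_on_ten_curve :
    z ^ 8 ∣ W0.Δ + 16 * a3 ^ 2 * a4 ^ 3 * z ^ 7 := by
  refine ⟨-16 * a4 ^ 2 * (4 * a4 * a0 - a2 ^ 2) - 64 * a2 ^ 3 * z
    - 27 * (a3 ^ 2 + 4 * a0 * z) ^ 2 + 72 * a4 * a2 * (a3 ^ 2 + 4 * a0 * z), ?_⟩
  simp only [W0, WeierstrassCurve.Δ, WeierstrassCurve.b₂, WeierstrassCurve.b₄,
    WeierstrassCurve.b₆, WeierstrassCurve.b₈]
  ring
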